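/- Let G be a finite simple graph on the vertex set {1,…,ℓ}. If G is weakly chordal but not chordal, then the projective dimension of the S-module D(A(G)) is exactly 1. -/

import Mathlib

open MvPolynomial CategoryTheory

/-- The polynomial ring `S = ℚ[x_1, …, x_ℓ]` (variables indexed by `Fin ℓ`). -/
abbrev Spoly (ℓ : ℕ) : Type := MvPolynomial (Fin ℓ) ℚ

/-- The module `D(A(G))` of logarithmic derivations of the graphic arrangement of a
graph `G` on the vertex set `{1, …, ℓ}`: all `θ ∈ Der_ℚ(S)` such that `(x_i - x_j)`
divides `θ(x_i) - θ(x_j)` for every edge `{i, j}` of `G`. -/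
noncomputable def logDer (ℓ : ℕ) (G : SimpleGraph (Fin ℓ)) :
    Submodule (Spoly ℓ) (Derivation ℚ (Spoly ℓ) (Spoly ℓ)) where
  carrier := {θ | ∀ i j : Fin ℓ, G.Adj i j → (X i - X j) ∣ θ (X i) - θ (X j)}
  add_mem' := by
    intro a b ha hb i j h
    have : (a + b) (X i) - (a + b) (X j)
        = (a (X i) - a (X j)) + (b (X i) - b (X j)) := by
      simp only [Derivation.add_apply]; ring
    rw [this]
    exact dvd_add (ha i j h) (hb i j h)
  zero_mem' := by intro i j h; simp
  smul_mem' := by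
    intro c θ hθ i j h
    have : (c • θ) (X i) - (c • θ) (X j) = c * (θ (X i) - θ (X j)) := by
      simp only [Derivation.smul_apply, smul_eq_mul]; ring
    rw [this]
    exact (hθ i j h).mul_left c

/-- `pdLE M n` : `M` admits a projective resolution vanishing in homological
degrees above `n`, i.e. the projective dimension of `M` is at most `n`. -/
def pdLE {R : Type} [CommRing R] (M : ModuleCat R) (n : ℕ) : Prop :=
  ∃ P : ProjectiveResolution M, ∀ i : ℕ, n < i → Limits.IsZero (P.complex.X i)

/-- The projective dimension of a module, as an element of `ℕ∞`
(infimum of the lengths of projective resolutions; `⊤` if there is none of finite length). -/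
noncomputable def pd {R : Type} [CommRing R] (M : ModuleCat R) : ℕ∞ :=
  sInf {n : ℕ∞ | ∃ k : ℕ, (k : ℕ∞) = n ∧ pdLE M k}

/-- `G` contains an induced cycle of length `n`, i.e. an induced subgraph
isomorphic to the cycle graph on `n` vertices. -/
def HasInducedCycleLen {V : Type} (G : SimpleGraph V) (n : ℕ) : Prop :=
  ∃ s : Set V, Nonempty (G.induce s ≃g SimpleGraph.cycleGraph n)

/-- A graph is chordal if it has no induced cycle of length at least 4. -/
def Chordal {V : Type} (G : SimpleGraph V) : Prop :=
  ∀ n : ℕ, 4 ≤ n → ¬ HasInducedCycleLen G n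

/-- A graph is weakly chordal if neither it nor its complement contains an
induced cycle of length at least 5. -/
def WeaklyChordal {V : Type} (G : SimpleGraph V) : Prop :=
  (∀ n : ℕ, 5 ≤ n → ¬ HasInducedCycleLen G n) ∧
  (∀ n : ℕ, 5 ≤ n → ¬ HasInducedCycleLen Gᶜ n)

lemma projective_of_pdLE_zero {R : Type} [CommRing R] {M : ModuleCat R} (h : pdLE M 0) :
    Projective M := by
  obtain ⟨P, hP⟩ := h
  have hmono : Mono (P.π.f 0) := by
    have hex := P.exact₀
    exact hex.mono_g ((hP 1 one_pos).eq_of_src _ _)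
  have hepi : Epi (P.π.f 0) := inferInstance
  let f : P.complex.X 0 ⟶ M := P.π.f 0
  have : IsIso f := @isIso_of_mono_of_epi _ _ _ _ _ f hmono hepi
  exact Projective.of_iso (asIso f) (P.projective 0)

lemma pdLE_one_of_hasProjectiveDimensionLE {R : Type} [CommRing R] {M : ModuleCat R}
    (h : HasProjectiveDimensionLE M 1) : pdLE M 1 := by
  let S : ShortComplex (ModuleCat R) :=
    ShortComplex.mk (Limits.kernel.ι (Projective.π M)) (Projective.π M) (Limits.kernel.condition _)
  have hS : S.ShortExact :=
    { exact := ShortComplex.exact_of_f_is_kernel _ (Limits.kernelIsKernel (Projective.π M))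
      mono_f := inferInstanceAs (Mono (Limits.kernel.ι (Projective.π M)))
      epi_g := inferInstanceAs (Epi (Projective.π M)) }
  have h₁ : HasProjectiveDimensionLT S.X₁ 1 :=
    hS.hasProjectiveDimensionLT_X₁ 1
      (inferInstanceAs (HasProjectiveDimensionLT (Projective.over M) 1)) h
  have p₁ : Projective S.X₁ := projective_iff_hasProjectiveDimensionLT_one.2 h₁
  have p₂ : Projective S.X₂ := inferInstanceAs (Projective (Projective.over M))
  let C : ChainComplex (ModuleCat R) ℕ :=
    ChainComplex.augment ((ChainComplex.single₀ (ModuleCat R)).obj S.X₁) S.f (by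
      rw [HomologicalComplex.single_obj_d]; exact Limits.zero_comp)
  have z : ∀ n, Limits.IsZero (C.X (n + 2)) := fun n =>
    HomologicalComplex.isZero_single_obj_X (ComplexShape.down ℕ) 0 S.X₁ (n + 1) (by simp)
  have hex : ∀ n, C.ExactAt (n + 1) := by
    intro n
    rw [HomologicalComplex.exactAt_iff' _ (n + 1 + 1) (n + 1) n (by simp) (by simp)]
    cases n with
    | zero =>
      have : Mono (C.d 1 0) := hS.mono_f
      exact (ShortComplex.exact_iff_mono _ ((z 0).eq_of_src _ _)).2 this
    | succ n => exact ShortComplex.exact_of_isZero_X₂ _ (z n)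
  have hp : ∀ n, Projective (C.X n) := by
    rintro (_ | _ | n)
    · exact p₂
    · exact p₁
    · exact Projective.of_iso (z n).isoZero.symm inferInstance
  refine ⟨{ complex := C
            projective := hp
            π := (ChainComplex.toSingle₀Equiv _ _).symm ⟨S.g, S.zero⟩
            quasiIso := ⟨fun n => ?_⟩ }, ?_⟩
  · cases n with
    | zero =>
      rw [ChainComplex.quasiIsoAt₀_iff, ShortComplex.quasiIso_iff_of_zeros']
      · refine (ShortComplex.exact_and_epi_g_iff_of_iso ?_).2 ⟨hS.exact, hS.epi_g⟩
        refine ShortComplex.isoMk (Iso.refl _) (Iso.refl _) (Iso.refl _)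
          (by simp; rfl) ?_
        have key : ((ChainComplex.toSingle₀Equiv C M).symm ⟨S.g, S.zero⟩).f 0 = S.g :=
          ChainComplex.toSingle₀Equiv_symm_apply_f_zero (C := C) S.g S.zero
        exact (Category.id_comp _).trans (key.symm.trans (Category.comp_id _).symm)
      all_goals rfl
    | succ n =>
      rw [quasiIsoAt_iff_exactAt']
      · exact hex n
      · apply ChainComplex.exactAt_succ_single_obj
  · rintro (_ | _ | n) hn
    · omega
    · omega
    · exact z n

section Merge

variable {σ K : Type} [Field K]

lemma X_sub_X_ne_zero {i j : σ} (h : i ≠ j) : (X i - X j : MvPolynomial σ K) ≠ 0 :=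
  sub_ne_zero.2 fun H => h (X_injective H)

lemma prod_X_sub_X_ne_zero {b : σ} {A : Finset σ} (hb : b ∉ A) :
    (∏ u ∈ A, (X b - X u) : MvPolynomial σ K) ≠ 0 :=
  Finset.prod_ne_zero_iff.2 fun _ hu => X_sub_X_ne_zero fun h => hb (h ▸ hu)

variable [DecidableEq σ]

/-- The substitution sending `X i` and `X j` to `X b`. -/
noncomputable def merge (K : Type) [Field K] (b i j : σ) :
    MvPolynomial σ K →ₐ[K] MvPolynomial σ K :=
  aeval fun k => if k = i ∨ k = j then X b else X k

lemma merge_X (b i j k : σ) :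
    merge K b i j (X k) = if k = i ∨ k = j then X b else X k := by
  simp [merge]

lemma merge_X_self (b i j : σ) : merge K b i j (X b) = X b := by
  simp [merge_X]

lemma merge_X_left (b i j : σ) : merge K b i j (X i) = X b := by
  simp [merge_X]

lemma merge_X_right (b i j : σ) : merge K b i j (X j) = X b := by
  simp [merge_X]

lemma merge_X_of_ne {b i j k : σ} (hi : k ≠ i) (hj : k ≠ j) : merge K b i j (X k) = X k := by
  simp [merge_X, hi, hj]

lemma sub_merge_mem (b i j : σ) (p : MvPolynomial σ K) :
    p - merge K b i j p ∈ Ideal.span {X b - X i, X b - X j} := by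
  rw [← Ideal.Quotient.eq]
  have : (Ideal.Quotient.mkₐ K (Ideal.span {X b - X i, X b - X j} : Ideal (MvPolynomial σ K))).comp
      (merge K b i j) = Ideal.Quotient.mkₐ K _ := by
    ext k
    simp only [AlgHom.comp_apply, Ideal.Quotient.mkₐ_eq_mk, merge_X]
    split_ifs with h
    · rw [Ideal.Quotient.eq]
      rcases h with rfl | rfl <;> exact Ideal.subset_span (by simp)
    · rfl
  exact (DFunLike.congr_fun this p).symm

lemma mem_span_pair_iff_merge (b i j : σ) (p : MvPolynomial σ K) :
    p ∈ Ideal.span {X b - X i, X b - X j} ↔ merge K b i j p = 0 := by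
  constructor
  · intro h
    obtain ⟨g, h, rfl⟩ := Ideal.mem_span_pair.1 h
    simp [merge_X_self, merge_X_left, merge_X_right]
  · intro h
    simpa [h] using sub_merge_mem b i j p

lemma dvd_iff_merge (b i : σ) (p : MvPolynomial σ K) :
    X b - X i ∣ p ↔ merge K b i i p = 0 := by
  rw [← mem_span_pair_iff_merge, Set.pair_eq_singleton, Ideal.mem_span_singleton]

lemma dvd_sub_merge (b i : σ) (p : MvPolynomial σ K) : X b - X i ∣ p - merge K b i i p := by
  rw [← Ideal.mem_span_singleton, ← Set.pair_eq_singleton]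
  exact sub_merge_mem b i i p

lemma merge_prod {b i j : σ} {A : Finset σ} (hi : i ∉ A) (hj : j ∉ A) :
    merge K b i j (∏ u ∈ A, (X b - X u)) = ∏ u ∈ A, (X b - X u) := by
  rw [map_prod]
  refine Finset.prod_congr rfl fun u hu => ?_
  rw [map_sub, merge_X_self, merge_X_of_ne (fun h : u = i => hi (h ▸ hu))
    (fun h : u = j => hj (h ▸ hu))]

lemma mem_span_pair_of_mul_mem {b i j : σ} {p g : MvPolynomial σ K} (hp : merge K b i j p ≠ 0)
    (h : p * g ∈ Ideal.span {X b - X i, X b - X j}) :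
    g ∈ Ideal.span {X b - X i, X b - X j} := by
  rw [mem_span_pair_iff_merge, map_mul] at h
  rw [mem_span_pair_iff_merge]
  exact (mul_eq_zero.1 h).resolve_left hp

lemma dvd_of_dvd_mul_of_merge {b i : σ} {p g : MvPolynomial σ K} (hp : merge K b i i p ≠ 0)
    (h : X b - X i ∣ p * g) : X b - X i ∣ g := by
  rw [dvd_iff_merge, map_mul] at h
  rw [dvd_iff_merge]
  exact (mul_eq_zero.1 h).resolve_left hp

lemma isRelPrime_X_sub_X {b i j : σ} (hi : b ≠ i) (hj : b ≠ j) (hij : i ≠ j) :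
    IsRelPrime (X b - X i : MvPolynomial σ K) (X b - X j) := by
  have hp : Prime (X b - X i : MvPolynomial σ K) := by
    refine ⟨X_sub_X_ne_zero hi, fun h => ?_, fun p q h => ?_⟩
    · have := (dvd_iff_merge b i (1 : MvPolynomial σ K)).1 h.dvd
      simp at this
    · simpa only [dvd_iff_merge, map_mul, mul_eq_zero] using h
  rw [hp.irreducible.isRelPrime_iff_not_dvd, dvd_iff_merge, map_sub, merge_X_self,
    merge_X_of_ne hij.symm hij.symm]
  exact X_sub_X_ne_zero hj

end Merge

lemma mem_span_prod_of_forall {ι R : Type} [CommRing R] (y : ι → R) (q F : R) (A : Finset ι)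
    (hnz : ∀ u ∈ A, ∀ v ∈ A, u ≠ v → ∀ g, y v * g ∈ Ideal.span {y u, q} → g ∈ Ideal.span {y u, q})
    (hF : ∀ u ∈ A, F ∈ Ideal.span {y u, q}) : F ∈ Ideal.span {∏ u ∈ A, y u, q} := by
  classical
  induction A using Finset.induction_on with
  | empty => exact Ideal.mem_span_pair.2 ⟨F, 0, by simp⟩
  | insert u A hu ih =>
    obtain ⟨g, h, hgh⟩ := Ideal.mem_span_pair.1 (ih
      (fun v hv w hw => hnz v (Finset.mem_insert_of_mem hv) w (Finset.mem_insert_of_mem hw))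
      (fun v hv => hF v (Finset.mem_insert_of_mem hv)))
    have h₁ : (∏ v ∈ A, y v) * g ∈ Ideal.span {y u, q} := by
      have : (∏ v ∈ A, y v) * g = F - h * q := by rw [← hgh]; ring
      rw [this]
      exact sub_mem (hF u (Finset.mem_insert_self _ _))
        (Ideal.mul_mem_left _ _ (Ideal.subset_span (by simp)))
    have h₂ : ∀ B ⊆ A, ∀ g, (∏ v ∈ B, y v) * g ∈ Ideal.span {y u, q} →
        g ∈ Ideal.span {y u, q} := by
      intro B
      induction B using Finset.induction_on with
      | empty => intro _ g hg; simpa using hg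
      | insert v B hv ihB =>
        intro hB g hg
        rw [Finset.prod_insert hv, mul_assoc] at hg
        have hvA : v ∈ A := hB (Finset.mem_insert_self _ _)
        exact ihB (fun w hw => hB (Finset.mem_insert_of_mem hw)) g
          (hnz u (Finset.mem_insert_self _ _) v (Finset.mem_insert_of_mem hvA)
            (fun h => hu (h ▸ hvA)) _ hg)
    obtain ⟨m, n, hmn⟩ := Ideal.mem_span_pair.1 (h₂ A subset_rfl g h₁)
    refine Ideal.mem_span_pair.2 ⟨m, h + (∏ v ∈ A, y v) * n, ?_⟩
    rw [Finset.prod_insert hu, ← hgh, ← hmn]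
    ring

lemma mem_span_prod_prod {σ K : Type} [DecidableEq σ] [Field K] {b : σ} {A B : Finset σ}
    (hA : b ∉ A) (hB : b ∉ B) (hAB : Disjoint A B) {F : MvPolynomial σ K}
    (hF : ∀ u ∈ A, ∀ v ∈ B, F ∈ Ideal.span {X b - X u, X b - X v}) :
    F ∈ Ideal.span {∏ u ∈ A, (X b - X u), ∏ v ∈ B, (X b - X v)} := by
  have hne : ∀ {u v}, u ∈ A → v ∈ B → u ≠ v := fun hu hv h =>
    Finset.disjoint_left.1 hAB hu (h ▸ hv)
  have hcancel : ∀ {w u v}, w ≠ b → w ≠ u → w ≠ v → ∀ g : MvPolynomial σ K,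
      (X b - X w) * g ∈ Ideal.span {X b - X u, X b - X v} →
      g ∈ Ideal.span {X b - X u, X b - X v} := by
    intro w u v hb hu hv g hg
    refine mem_span_pair_of_mul_mem ?_ hg
    rw [map_sub, merge_X_self, merge_X_of_ne hu hv]
    exact X_sub_X_ne_zero hb.symm
  have hstep : ∀ u ∈ A, ∀ G : MvPolynomial σ K,
      (∀ v ∈ B, G ∈ Ideal.span {X b - X u, X b - X v}) →
      G ∈ Ideal.span {X b - X u, ∏ v ∈ B, (X b - X v)} := by
    intro u hu G hG
    rw [Set.pair_comm]
    refine mem_span_prod_of_forall (fun v => X b - X v) _ _ B ?_ ?_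
    · intro v hv w hw hvw g hg
      exact hcancel (fun h => hB (h ▸ hw)) hvw.symm (hne hu hw).symm g hg
    · intro v hv
      rw [Set.pair_comm]
      exact hG v hv
  refine mem_span_prod_of_forall (fun u => X b - X u) _ _ A ?_ ?_
  · intro u hu w hw huw g hg
    refine hstep u hu g fun v hv => ?_
    refine hcancel (fun h => hA (h ▸ hw)) huw.symm (hne hw hv) g ?_
    refine Ideal.span_le.2 ?_ hg
    rintro x (rfl | rfl)
    · exact Ideal.subset_span (by simp)
    · exact Ideal.mem_of_dvd _ (Finset.dvd_prod_of_mem _ hv) (Ideal.subset_span (by simp))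
  · intro u hu
    exact hstep u hu F (hF u hu)

lemma hasProjectiveDimensionLT_one_of_projective (R M : Type) [CommRing R] [AddCommGroup M]
    [Module R M] [Module.Projective R M] : HasProjectiveDimensionLT (ModuleCat.of R M) 1 :=
  projective_iff_hasProjectiveDimensionLT_one.1
    ((IsProjective.iff_projective (R := R) M).1 inferInstance)

/-- A submodule cut out by divisibility `α ∣ δ θ`, where `δ` modulo `α` has image `B • (P, Q)`
for `P`, `Q` coprime modulo `α`, has projective dimension at most one if the ambient module has. -/
lemma hasProjectiveDimensionLT_two_of_dvd {R M : Type} [CommRing R] [IsDomain R] [AddCommGroup M]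
    [Module R M] (hM : HasProjectiveDimensionLT (ModuleCat.of R M) 2) (δ : M →ₗ[R] R)
    (D : Submodule R M) (α B P Q : R) (hD : ∀ θ, θ ∈ D ↔ α ∣ δ θ) (hα : α ≠ 0)
    (hQ : ∀ r, α ∣ r * Q → α ∣ r) (hB : ∀ r, α ∣ B * r → α ∣ r)
    (hPQ : ∀ g h, α ∣ g * P + h * Q → ∃ r, α ∣ g - r * Q ∧ α ∣ h + r * P)
    (η₁ η₂ : M) (h₁ : α ∣ δ η₁ - B * P) (h₂ : α ∣ δ η₂ - B * Q)
    (hδ : ∀ θ, ∃ g h, α ∣ δ θ - B * (g * P + h * Q)) :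
    HasProjectiveDimensionLT (ModuleCat.of R D) 2 := by
  have key : ∀ g h, α ∣ δ (g • η₁ + h • η₂) - B * (g * P + h * Q) := by
    intro g h
    have : δ (g • η₁ + h • η₂) - B * (g * P + h * Q)
        = g * (δ η₁ - B * P) + h * (δ η₂ - B * Q) := by
      simp only [map_add, map_smul, smul_eq_mul]; ring
    rw [this]
    exact dvd_add (h₁.mul_left _) (h₂.mul_left _)
  have mem_iff : ∀ g h, g • η₁ + h • η₂ ∈ D ↔ α ∣ g * P + h * Q := by
    intro g h
    rw [hD, (dvd_iff_dvd_of_dvd_sub (key g h))]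
    exact ⟨hB _, fun H => H.mul_left _⟩
  let φ : D × R × R →ₗ[R] M := D.subtype.coprod
    ((LinearMap.toSpanSingleton R M η₁).coprod (LinearMap.toSpanSingleton R M η₂))
  have hφ : ∀ θ g h, φ (θ, g, h) = θ + (g • η₁ + h • η₂) := fun θ g h => rfl
  have φ_surj : Function.Surjective φ := by
    intro θ
    obtain ⟨g, h, hgh⟩ := hδ θ
    refine ⟨(⟨θ - (g • η₁ + h • η₂), ?_⟩, g, h), by simp [hφ]⟩
    rw [hD, map_sub]
    simpa using dvd_sub hgh (key g h)
  let ψ₀ : R × R × R →ₗ[R] R × R :=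
    { toFun := fun x => (x.1 * Q + α * x.2.1, -(x.1 * P) + α * x.2.2)
      map_add' := by intro x y; ext <;> simp <;> ring
      map_smul' := by intro c x; ext <;> simp <;> ring }
  let ψ₁ : R × R × R →ₗ[R] M :=
    ((LinearMap.toSpanSingleton R M η₁).coprod (LinearMap.toSpanSingleton R M η₂)) ∘ₗ ψ₀
  have hψ₁ : ∀ x, ψ₁ x ∈ D := by
    intro x
    refine (mem_iff (ψ₀ x).1 (ψ₀ x).2).2 ⟨x.2.1 * P + x.2.2 * Q, ?_⟩
    change (x.1 * Q + α * x.2.1) * P + (-(x.1 * P) + α * x.2.2) * Q = _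
    ring
  let ψ : R × R × R →ₗ[R] LinearMap.ker φ :=
    LinearMap.codRestrict _ ((-(ψ₁.codRestrict D hψ₁)).prod ψ₀) (by
      intro x
      rw [LinearMap.mem_ker]
      exact neg_add_cancel (ψ₁ x))
  have hψ : ∀ x, (ψ x : D × R × R).2 = ψ₀ x := fun x => rfl
  have ψ_surj : Function.Surjective ψ := by
    rintro ⟨⟨θ, g, h⟩, hx⟩
    rw [LinearMap.mem_ker, hφ] at hx
    have hmem : g • η₁ + h • η₂ ∈ D := by
      rw [← neg_eq_of_add_eq_zero_right hx]
      exact D.neg_mem θ.2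
    obtain ⟨r, ⟨s, hs⟩, ⟨t, ht⟩⟩ := hPQ g h ((mem_iff g h).1 hmem)
    have h0 : ψ₀ (r, s, t) = (g, h) := by
      ext
      · simp only [ψ₀, LinearMap.coe_mk, AddHom.coe_mk]; linear_combination - hs
      · simp only [ψ₀, LinearMap.coe_mk, AddHom.coe_mk]; linear_combination - ht
    refine ⟨(r, s, t), Subtype.ext (Prod.ext (Subtype.ext ?_) h0)⟩
    change -(((LinearMap.toSpanSingleton R M η₁).coprod (LinearMap.toSpanSingleton R M η₂))
      (ψ₀ (r, s, t))) = θ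
    rw [h0]
    exact neg_eq_of_add_eq_zero_left hx
  let ι : R →ₗ[R] R × R × R := LinearMap.toSpanSingleton R _ (α, -Q, P)
  have hι : ∀ r, ι r = (r * α, -(r * Q), r * P) := by
    intro r; simp [ι, LinearMap.toSpanSingleton_apply]
  have ι_inj : Function.Injective ι := by
    intro r s hrs
    rw [hι, hι] at hrs
    exact mul_right_cancel₀ hα (Prod.ext_iff.1 hrs).1
  have exact_ι_ψ : Function.Exact ι ψ := by
    rintro ⟨r, s, t⟩
    constructor
    · intro H
      have h0 : ψ₀ (r, s, t) = 0 := by rw [← hψ, H]; rfl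
      have e₁ : r * Q + α * s = 0 := (Prod.ext_iff.1 h0).1
      have e₂ : -(r * P) + α * t = 0 := (Prod.ext_iff.1 h0).2
      obtain ⟨k, rfl⟩ := hQ r ⟨-s, by linear_combination e₁⟩
      refine ⟨k, ?_⟩
      rw [hι]
      refine Prod.ext (mul_comm _ _) (Prod.ext ?_ ?_)
      · exact mul_left_cancel₀ hα (by linear_combination - e₁)
      · exact mul_left_cancel₀ hα (by linear_combination - e₂)
    · rintro ⟨k, hk⟩
      have h0 : ψ₀ (r, s, t) = 0 := by
        rw [← hk, hι]
        ext <;> simp only [ψ₀, LinearMap.coe_mk, AddHom.coe_mk, Prod.fst_zero, Prod.snd_zero] <;>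
          ring
      refine Subtype.ext (Prod.ext (Subtype.ext ?_) h0)
      change -(((LinearMap.toSpanSingleton R M η₁).coprod (LinearMap.toSpanSingleton R M η₂))
        (ψ₀ (r, s, t))) = 0
      rw [h0, map_zero, neg_zero]
  have hN : HasProjectiveDimensionLT (ModuleCat.of R (LinearMap.ker φ)) 2 :=
    (ModuleCat.shortComplex_shortExact (ShortComplex.mk (ModuleCat.ofHom ι) (ModuleCat.ofHom ψ)
      (by ext1; exact exact_ι_ψ.linearMap_comp_eq_zero)) exact_ι_ψ ι_inj
      ψ_surj).hasProjectiveDimensionLT_X₃ 1 (hasProjectiveDimensionLT_one_of_projective R R)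
      (@instHasProjectiveDimensionLTSucc _ _ _ _ _
        (hasProjectiveDimensionLT_one_of_projective R (R × R × R)))
  have hE : HasProjectiveDimensionLT (ModuleCat.of R (D × R × R)) 2 :=
    (LinearMap.shortExact_shortComplexKer φ_surj).hasProjectiveDimensionLT_X₂ 2 hN hM
  let ret : Retract (ModuleCat.of R D) (ModuleCat.of R (D × R × R)) :=
    { i := ModuleCat.ofHom (LinearMap.inl R D (R × R))
      r := ModuleCat.ofHom (LinearMap.fst R D (R × R))
      retract := by ext1; exact LinearMap.fst_comp_inl R D (R × R) }
  exact ret.hasProjectiveDimensionLT 2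

/-- The module of logarithmic derivations of a graphic arrangement, written in coordinates. -/
def logVec {σ : Type} (K : Type) [Field K] (G : SimpleGraph σ) :
    Submodule (MvPolynomial σ K) (σ → MvPolynomial σ K) where
  carrier := {f | ∀ i j, G.Adj i j → X i - X j ∣ f i - f j}
  add_mem' := by
    intro f g hf hg i j h
    rw [Pi.add_apply, Pi.add_apply, add_sub_add_comm]
    exact dvd_add (hf i j h) (hg i j h)
  zero_mem' := by intro i j _; simp
  smul_mem' := by
    intro c f hf i j h
    rw [Pi.smul_apply, Pi.smul_apply, ← smul_sub]
    exact (hf i j h).mul_left c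

section LogVec

variable {σ K : Type} [Field K]

lemma mem_logVec {G : SimpleGraph σ} {f : σ → MvPolynomial σ K} :
    f ∈ logVec K G ↔ ∀ i j, G.Adj i j → X i - X j ∣ f i - f j := Iff.rfl

lemma dvd_sub_of_dvd_sub_symm {i j : σ} {f : σ → MvPolynomial σ K}
    (h : X i - X j ∣ f i - f j) : X j - X i ∣ f j - f i := by
  rwa [← neg_sub (X i), ← neg_sub (f i), neg_dvd, dvd_neg]

lemma single_mem_logVec [DecidableEq σ] {G : SimpleGraph σ} {a : σ} {p : MvPolynomial σ K}
    (h : ∀ u, G.Adj a u → X a - X u ∣ p) : Pi.single a p ∈ logVec K G := by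
  intro i j hij
  rcases eq_or_ne i a with rfl | hi
  · simpa [hij.ne'] using h j hij
  rcases eq_or_ne j a with rfl | hj
  · have := h i hij.symm
    rw [← neg_sub, neg_dvd] at this
    simpa [hi] using this
  · simp [hi, hj]

lemma logVec_bot : logVec K (⊥ : SimpleGraph σ) = ⊤ := by
  ext f
  simp [mem_logVec]

lemma logVec_anti {G H : SimpleGraph σ} (h : G ≤ H) : logVec K H ≤ logVec K G :=
  fun _ hf i j hij => hf i j (h hij)

lemma hasProjectiveDimensionLT_logVec_of_edge [Fintype σ] [DecidableEq σ] {G : SimpleGraph σ}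
    {a b : σ} (hab : G.Adj a b)
    (hN : ∀ u v, G.Adj a u → G.Adj b v → u ≠ b → v ≠ a → ¬ G.Adj b u → ¬ G.Adj a v → G.Adj u v)
    (hG : HasProjectiveDimensionLT
      (ModuleCat.of (MvPolynomial σ K) (logVec K (G.deleteEdges {s(a, b)}))) 2) :
    HasProjectiveDimensionLT (ModuleCat.of (MvPolynomial σ K) (logVec K G)) 2 := by
  classical
  set H := G.deleteEdges {s(a, b)} with hH
  have hle : H ≤ G := G.deleteEdges_le _
  have hHadj : ∀ {i j}, G.Adj i j → (i = a → j ≠ b) → (i = b → j ≠ a) → H.Adj i j := by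
    intro i j h h₁ h₂
    rw [hH, SimpleGraph.deleteEdges_adj]
    refine ⟨h, ?_⟩
    simp only [Set.mem_singleton_iff, Sym2.eq_iff]
    rintro (⟨rfl, rfl⟩ | ⟨rfl, rfl⟩)
    · exact h₁ rfl rfl
    · exact h₂ rfl rfl
  have hHab : ¬ H.Adj a b := by simp [hH]
  have hne : a ≠ b := hab.ne
  set A : Finset σ := {u | G.Adj a u ∧ u ≠ b ∧ ¬ G.Adj b u} with hA
  set B : Finset σ := {v | G.Adj b v ∧ v ≠ a ∧ ¬ G.Adj a v} with hB
  set C : Finset σ := {c | G.Adj a c ∧ G.Adj b c} with hC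
  have haA : a ∉ A := by simp [hA]
  have hbA : b ∉ A := by simp [hA]
  have haB : a ∉ B := by simp [hB]
  have hbB : b ∉ B := by simp [hB]
  have haC : a ∉ C := by simp [hC]
  have hbC : b ∉ C := by simp [hC]
  have hAB : Disjoint A B := by
    rw [Finset.disjoint_left]
    intro u hu hv
    simp only [hA, hB, Finset.mem_filter_univ] at hu hv
    exact hu.2.2 hv.1
  set M := logVec K H
  set δ : M →ₗ[MvPolynomial σ K] MvPolynomial σ K :=
    (LinearMap.proj (R := MvPolynomial σ K) (φ := fun _ : σ => MvPolynomial σ K) a -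
      LinearMap.proj b) ∘ₗ M.subtype with hδdef
  have hδ : ∀ θ : M, δ θ = θ.1 a - θ.1 b := fun θ => rfl
  set P : MvPolynomial σ K := ∏ u ∈ A, (X b - X u) with hP
  set Q : MvPolynomial σ K := ∏ u ∈ B, (X b - X u) with hQ
  set R : MvPolynomial σ K := ∏ u ∈ C, (X b - X u) with hR
  have hτP : merge K b a a P = P := merge_prod haA haA
  have hτQ : merge K b a a Q = Q := merge_prod haB haB
  have hτR : merge K b a a R = R := merge_prod haC haC
  have hP0 : P ≠ 0 := prod_X_sub_X_ne_zero hbA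
  have hQ0 : Q ≠ 0 := prod_X_sub_X_ne_zero hbB
  have hR0 : R ≠ 0 := prod_X_sub_X_ne_zero hbC
  have hη₁ : Pi.single a ((∏ u ∈ C, (X a - X u)) * ∏ u ∈ A, (X a - X u)) ∈ M := by
    refine single_mem_logVec fun u hu => ?_
    have hub : u ≠ b := fun h => hHab (h ▸ hu)
    by_cases h : G.Adj b u
    · exact (Finset.dvd_prod_of_mem (fun u => (X a - X u : MvPolynomial σ K))
        (by simp [hC, h, hle hu])).mul_right _
    · exact (Finset.dvd_prod_of_mem (fun u => (X a - X u : MvPolynomial σ K))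
        (by simp [hA, h, hle hu, hub])).mul_left _
  have hη₂ : Pi.single b (-(R * Q)) ∈ M := by
    refine single_mem_logVec fun u hu => ?_
    have hua : u ≠ a := fun h => hHab (h ▸ hu).symm
    rw [dvd_neg]
    by_cases h : G.Adj a u
    · exact (Finset.dvd_prod_of_mem (fun u => (X b - X u : MvPolynomial σ K))
        (by simp [hC, h, hle hu])).mul_right _
    · exact (Finset.dvd_prod_of_mem (fun u => (X b - X u : MvPolynomial σ K))
        (by simp [hB, h, hle hu, hua])).mul_left _
  have hδ₁ : δ ⟨_, hη₁⟩ = (∏ u ∈ C, (X a - X u)) * ∏ u ∈ A, (X a - X u) := by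
    simp [hδ, hne.symm]
  have hδ₂ : δ ⟨_, hη₂⟩ = R * Q := by
    simp [hδ, hne]
  have key := hasProjectiveDimensionLT_two_of_dvd hG δ ((logVec K G).submoduleOf M)
    (X b - X a) R P Q ?_ (X_sub_X_ne_zero hne.symm) ?_ ?_ ?_ ⟨_, hη₁⟩ ⟨_, hη₂⟩ ?_ ?_ ?_
  · have e : (logVec K G).submoduleOf M ≃ₗ[MvPolynomial σ K] logVec K G :=
      Submodule.submoduleOfEquivOfLe (logVec_anti hle)
    have i : ModuleCat.of (MvPolynomial σ K) ((logVec K G).submoduleOf M) ≅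
      ModuleCat.of (MvPolynomial σ K) (logVec K G) := e.toModuleIso
    exact hasProjectiveDimensionLT_of_iso i 2
  · intro θ
    rw [Submodule.submoduleOf, Submodule.mem_comap, hδ, ← dvd_neg, neg_sub]
    refine ⟨fun h => h b a hab.symm, fun h i j hij => ?_⟩
    by_cases h₁ : i = a ∧ j = b
    · rw [h₁.1, h₁.2]
      exact dvd_sub_of_dvd_sub_symm h
    by_cases h₂ : i = b ∧ j = a
    · rw [h₂.1, h₂.2]
      exact h
    · exact θ.2 i j (hHadj hij (fun hi hj => h₁ ⟨hi, hj⟩) fun hi hj => h₂ ⟨hi, hj⟩)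
  · intro r hr
    rw [mul_comm] at hr
    exact dvd_of_dvd_mul_of_merge (by rwa [hτQ]) hr
  · intro r hr
    exact dvd_of_dvd_mul_of_merge (by rwa [hτR]) hr
  · intro g h hgh
    rw [dvd_iff_merge, map_add, map_mul, map_mul, hτP, hτQ] at hgh
    have hrel : IsRelPrime P Q := by
      refine IsRelPrime.prod_left fun u hu => IsRelPrime.prod_right fun v hv => ?_
      exact isRelPrime_X_sub_X (fun h => hbA (h ▸ hu)) (fun h => hbB (h ▸ hv))
        (fun h => Finset.disjoint_left.1 hAB hu (h ▸ hv))
    have hdvd : P ∣ Q * merge K b a a h :=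
      ⟨-merge K b a a g, by linear_combination hgh⟩
    obtain ⟨k, hk⟩ := hrel.dvd_of_dvd_mul_left hdvd
    have hk' : merge K b a a g = -k * Q := by
      apply mul_right_cancel₀ hP0
      rw [hk] at hgh
      linear_combination hgh
    refine ⟨-k, ?_, ?_⟩
    · rw [← hk']
      exact dvd_sub_merge b a g
    · have : h + -k * P = h - merge K b a a h := by rw [hk]; ring
      rw [this]
      exact dvd_sub_merge b a h
  · rw [hδ₁, dvd_iff_merge, map_sub, map_mul, map_mul, hτR, hτP, map_prod, map_prod]
    rw [hR, hP, sub_eq_zero]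
    congr 1 <;> refine Finset.prod_congr rfl fun u hu => ?_
    · have : u ≠ a := fun h => haC (h ▸ hu)
      rw [map_sub, merge_X_left, merge_X_of_ne this this]
    · have : u ≠ a := fun h => haA (h ▸ hu)
      rw [map_sub, merge_X_left, merge_X_of_ne this this]
  · rw [hδ₂, sub_self]
    exact dvd_zero _
  · intro θ
    set τ := merge K b a a with hτ
    have hfix : ∀ {u}, u ≠ a → τ (X u) = X u := fun hu => merge_X_of_ne hu hu
    have hedge : ∀ {i j}, H.Adj i j → τ (X i) - τ (X j) ∣ τ (θ.1 i) - τ (θ.1 j) := by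
      intro i j hij
      rw [← map_sub, ← map_sub]
      exact map_dvd τ (θ.2 i j hij)
    have hτa : τ (X a) = X b := merge_X_left b a a
    have hτb : τ (X b) = X b := merge_X_self b a a
    have hRdvd : R ∣ τ (δ θ) := by
      refine Finset.prod_dvd_of_isRelPrime ?_ ?_
      · intro c hc d hd hcd
        exact isRelPrime_X_sub_X (fun h => hbC (h ▸ hc)) (fun h => hbC (h ▸ hd)) hcd
      · intro c hc
        have hca : c ≠ a := fun h => haC (h ▸ hc)
        have hcb : c ≠ b := fun h => hbC (h ▸ hc)
        simp only [hC, Finset.mem_filter_univ] at hc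
        have h₁ := hedge (hHadj hc.1 (fun _ => hcb) (fun h => absurd h hne))
        have h₂ := hedge (hHadj hc.2 (fun h => absurd h hne.symm) (fun _ => hca))
        rw [hfix hca, hτa] at h₁
        rw [hfix hca, hτb] at h₂
        rw [hδ, map_sub]
        have := dvd_sub h₁ h₂
        rwa [sub_sub_sub_cancel_right] at this
    obtain ⟨F, hF⟩ := hRdvd
    have hFmem : F ∈ Ideal.span {P, Q} := by
      refine mem_span_prod_prod hbA hbB hAB fun u hu v hv => ?_
      have hua : u ≠ a := fun h => haA (h ▸ hu)
      have hub : u ≠ b := fun h => hbA (h ▸ hu)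
      have hva : v ≠ a := fun h => haB (h ▸ hv)
      have hvb : v ≠ b := fun h => hbB (h ▸ hv)
      have huC : u ∉ C := by
        simp only [hA, Finset.mem_filter_univ] at hu
        simp [hC, hu.2.2]
      have hvC : v ∉ C := by
        simp only [hB, Finset.mem_filter_univ] at hv
        simp [hC, hv.2.2]
      refine mem_span_pair_of_mul_mem (p := R) (by rwa [merge_prod huC hvC]) ?_
      simp only [hA, hB, Finset.mem_filter_univ] at hu hv
      rw [← hF, hδ, map_sub]
      have h₁ := hedge (hHadj hu.1 (fun _ => hub) (fun h => absurd h hne))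
      have h₂ := hedge (hHadj (hN u v hu.1 hv.1 hub hva hu.2.2 hv.2.2)
        (fun h => absurd h hua) (fun h => absurd h hub))
      have h₃ := hedge (hHadj hv.1 (fun h => absurd h hne.symm) (fun _ => hva))
      rw [hτa, hfix hua] at h₁
      rw [hfix hua, hfix hva] at h₂
      rw [hτb, hfix hva] at h₃
      obtain ⟨r₁, h₁⟩ := h₁
      obtain ⟨r₂, h₂⟩ := h₂
      obtain ⟨r₃, h₃⟩ := h₃
      exact Ideal.mem_span_pair.2 ⟨r₁ - r₂, r₂ - r₃, by linear_combination -h₁ - h₂ + h₃⟩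
    obtain ⟨g, h, hgh⟩ := Ideal.mem_span_pair.1 hFmem
    refine ⟨g, h, ?_⟩
    rw [hgh, ← hF]
    exact dvd_sub_merge b a _

end LogVec

/-- The vertices `c 0, …, c (n - 1)` form an induced cycle of `G`, in this order. -/
def IsInducedCycle {V : Type} (G : SimpleGraph V) (c : ℕ → V) (n : ℕ) : Prop :=
  ∀ i j, i < j → j < n → c i ≠ c j ∧ (G.Adj (c i) (c j) ↔ j = i + 1 ∨ i = 0 ∧ j + 1 = n)

lemma exists_smul_add_smul_of_projective {R D : Type} [CommRing R] [AddCommGroup D] [Module R D]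
    [Module.Projective R D] {a b c : R} {θ₁ θ₂ θ₃ : D}
    (ha : ∀ g, a * g ∈ Ideal.span {b, c} → g ∈ Ideal.span {b, c})
    (h : b • θ₃ = c • θ₁ + a • θ₂) : ∃ ν μ : D, θ₂ = b • ν + c • μ := by
  obtain ⟨s, hs⟩ := Module.projective_def.1 (inferInstance : Module.Projective R D)
  have hmem : ∀ k, ∃ g h, g * b + h * c = s θ₂ k := by
    intro k
    refine Ideal.mem_span_pair.1 (ha _ (Ideal.mem_span_pair.2 ⟨s θ₃ k, -s θ₁ k, ?_⟩))
    have := DFunLike.congr_fun (congrArg s h) k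
    simp only [map_add, map_smul, Finsupp.add_apply, Finsupp.smul_apply, smul_eq_mul] at this
    linear_combination this
  choose g h hgh using hmem
  refine ⟨∑ k ∈ (s θ₂).support, g k • k, ∑ k ∈ (s θ₂).support, h k • k, ?_⟩
  rw [Finset.smul_sum, Finset.smul_sum, ← Finset.sum_add_distrib]
  conv_lhs => rw [← hs θ₂, Finsupp.linearCombination_apply, Finsupp.sum]
  refine Finset.sum_congr rfl fun k _ => ?_
  rw [← hgh k, id, smul_smul, smul_smul, ← add_smul, mul_comm b, mul_comm c]

section NotProjective

variable {σ K : Type} [Field K]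

lemma dvd_of_dvd_mul_sub_of_ne [DecidableEq σ] {i j k l : σ} {g : MvPolynomial σ K}
    (hkl : k ≠ l) (h₁ : ¬ (i = k ∧ j = l)) (h₂ : ¬ (i = l ∧ j = k))
    (h : X i - X j ∣ (X k - X l) * g) : X i - X j ∣ g := by
  refine dvd_of_dvd_mul_of_merge ?_ h
  rw [map_sub, merge_X, merge_X]
  simp only [or_self]
  split_ifs with hk hl hl
  · exact absurd (hk.trans hl.symm) hkl
  · exact X_sub_X_ne_zero fun H => h₂ ⟨H, hk.symm⟩
  · exact X_sub_X_ne_zero fun H => h₁ ⟨H.symm, hl.symm⟩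
  · exact X_sub_X_ne_zero hkl

lemma not_projective_logVec [Fintype σ] {G : SimpleGraph σ} {c : ℕ → σ}
    {n : ℕ} (hn : 4 ≤ n) (hc : IsInducedCycle G c n) :
    ¬ Module.Projective (MvPolynomial σ K) (logVec K G) := by
  classical
  intro hproj
  set w := c 0 with hw
  set v₁ := c (n - 1) with hv₁
  set v₃ := c 1 with hv₃
  set v₀ := c (n - 2) with hv₀
  set s : Finset σ := (Finset.range n).image c with hs
  have hmem : ∀ i, i < n → c i ∈ s := fun i hi =>
    Finset.mem_image_of_mem _ (Finset.mem_range.2 hi)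
  have hwv₁ : w ≠ v₁ := (hc 0 (n - 1) (by omega) (by omega)).1
  have hwv₃ : w ≠ v₃ := (hc 0 1 (by omega) (by omega)).1
  have hwv₀ : w ≠ v₀ := (hc 0 (n - 2) (by omega) (by omega)).1
  have hv₃v₁ : v₃ ≠ v₁ := (hc 1 (n - 1) (by omega) (by omega)).1
  have hv₃v₀ : v₃ ≠ v₀ := (hc 1 (n - 2) (by omega) (by omega)).1
  have hv₀v₁ : v₀ ≠ v₁ := (hc (n - 2) (n - 1) (by omega) (by omega)).1
  have hadj : G.Adj w v₁ := (hc 0 (n - 1) (by omega) (by omega)).2.2 (Or.inr ⟨rfl, by omega⟩)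
  have hw_nbr : ∀ u ∈ s, G.Adj w u → u = v₁ ∨ u = v₃ := by
    intro u hu h
    obtain ⟨i, hi, rfl⟩ := Finset.mem_image.1 hu
    rw [Finset.mem_range] at hi
    rcases Nat.eq_zero_or_pos i with rfl | hi0
    · exact absurd rfl h.ne
    rcases ((hc 0 i hi0 hi).2.1 h) with h | h
    · right; rw [hv₃, h]
    · left; rw [hv₁, ← h.2, Nat.add_sub_cancel]
  have hv₁_nbr : ∀ u ∈ s, G.Adj v₁ u → u = w ∨ u = v₀ := by
    intro u hu h
    obtain ⟨i, hi, rfl⟩ := Finset.mem_image.1 hu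
    rw [Finset.mem_range] at hi
    rcases eq_or_ne i (n - 1) with rfl | hi0
    · exact absurd rfl h.ne
    rcases ((hc i (n - 1) (by omega) (by omega)).2.1 h.symm) with h | h
    · right; rw [hv₀]; congr 1; omega
    · left; rw [hw, h.1]
  set f : MvPolynomial σ K :=
    ∏ p : σ × σ with G.Adj p.1 p.2 ∧ ¬ (p.1 ∈ s ∧ p.2 ∈ s), (X p.1 - X p.2) with hf
  have hdvd : ∀ i j, G.Adj i j → ¬ (i ∈ s ∧ j ∈ s) → X i - X j ∣ f := by
    intro i j h h'
    exact Finset.dvd_prod_of_mem (fun p : σ × σ => (X p.1 - X p.2 : MvPolynomial σ K))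
      (a := (i, j)) (by simpa using ⟨h, by simpa using h'⟩)
  set φ : MvPolynomial σ K →ₐ[K] MvPolynomial σ K :=
    aeval fun i => if i ∈ s then 0 else X i with hφ
  have hφX : ∀ i, φ (X i) = if i ∈ s then 0 else X i := fun i => by simp [hφ]
  have hφf : φ f ≠ 0 := by
    rw [hf, map_prod, Finset.prod_ne_zero_iff]
    intro p hp
    simp only [Finset.mem_filter_univ] at hp
    rw [map_sub, hφX, hφX]
    split_ifs with h₁ h₂ h₂
    · exact absurd ⟨h₁, h₂⟩ hp.2
    · simp [X_ne_zero]
    · simp [X_ne_zero]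
    · exact X_sub_X_ne_zero hp.1.ne
  set a : MvPolynomial σ K := X v₁ - X v₀ with ha
  set b : MvPolynomial σ K := X w - X v₁ with hb
  set d : MvPolynomial σ K := X w - X v₃ with hd
  have hb0 : b ≠ 0 := X_sub_X_ne_zero hwv₁
  have hd0 : d ≠ 0 := X_sub_X_ne_zero hwv₃
  have hsw : w ∈ s := hmem 0 (by omega)
  have hsv₁ : v₁ ∈ s := hmem (n - 1) (by omega)
  have hθ₁ : Pi.single v₁ (a * b * f) ∈ logVec K G := by
    refine single_mem_logVec fun u hu => ?_
    by_cases hus : u ∈ s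
    · rcases hv₁_nbr u hus hu with rfl | rfl
      · rw [← neg_dvd, neg_sub]
        exact (dvd_mul_left b a).mul_right f
      · exact (dvd_mul_right a b).mul_right f
    · exact (hdvd _ _ hu fun h => hus h.2).mul_left _
  have hθ₂ : Pi.single w (b * d * f) ∈ logVec K G := by
    refine single_mem_logVec fun u hu => ?_
    by_cases hus : u ∈ s
    · rcases hw_nbr u hus hu with rfl | rfl
      · exact (dvd_mul_right b d).mul_right f
      · exact (dvd_mul_left d b).mul_right f
    · exact (hdvd _ _ hu fun h => hus h.2).mul_left _
  have hθ₃ : (fun k => if k = w ∨ k = v₁ then a * d * f else 0) ∈ logVec K G := by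
    have key : ∀ i j, G.Adj i j → (i = w ∨ i = v₁) → ¬ (j = w ∨ j = v₁) →
        X i - X j ∣ a * d * f := by
      rintro i j hij hi hj
      by_cases hjs : j ∈ s
      · rcases hi with rfl | rfl
        · rcases hw_nbr j hjs hij with rfl | rfl
          · exact absurd (Or.inr rfl) hj
          · exact (dvd_mul_left d a).mul_right f
        · rcases hv₁_nbr j hjs hij with rfl | rfl
          · exact absurd (Or.inl rfl) hj
          · exact (dvd_mul_right a d).mul_right f
      · exact (hdvd _ _ hij fun h => hjs h.2).mul_left _
    intro i j hij
    dsimp only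
    split_ifs with hi hj hj
    · simp
    · simpa using key i j hij hi hj
    · rw [zero_sub, dvd_neg, ← neg_dvd, neg_sub]
      exact key j i hij.symm hj hi
    · simp
  obtain ⟨ν, μ, hνμ⟩ := exists_smul_add_smul_of_projective (a := a) (b := b) (c := d)
    (θ₁ := (⟨_, hθ₁⟩ : logVec K G)) (θ₂ := ⟨_, hθ₂⟩) (θ₃ := ⟨_, hθ₃⟩)
    (fun g hg => mem_span_pair_of_mul_mem (by
      rw [ha, map_sub, merge_X_left, merge_X_of_ne hv₀v₁ hv₃v₀.symm]
      exact X_sub_X_ne_zero hwv₀) hg)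
    (by
      ext1
      funext k
      simp only [Submodule.coe_smul, Submodule.coe_add, Pi.smul_apply, Pi.add_apply, smul_eq_mul]
      rcases eq_or_ne k w with rfl | hk
      · rw [if_pos (Or.inl rfl), Pi.single_eq_of_ne hwv₁, Pi.single_eq_same]
        ring
      rcases eq_or_ne k v₁ with rfl | hk'
      · rw [if_pos (Or.inr rfl), Pi.single_eq_of_ne hwv₁.symm, Pi.single_eq_same]
        ring
      · simp [hk, hk'])
  have hcoord : ∀ k, Pi.single (M := fun _ => MvPolynomial σ K) w (b * d * f) k
      = b * ν.1 k + d * μ.1 k := fun k => congrFun (congrArg Subtype.val hνμ) k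
  have hsing : ∀ k, Pi.single (M := fun _ => MvPolynomial σ K) w (b * d * f) k =
      b * d * Pi.single (M := fun _ => MvPolynomial σ K) w f k := by
    intro k
    rcases eq_or_ne k w with rfl | hk
    · simp
    · simp [hk]
  have hν : ∀ k, d ∣ ν.1 k := by
    intro k
    refine dvd_of_dvd_mul_sub_of_ne hwv₁ (fun h => hv₃v₁ h.2) (fun h => hwv₁ h.1)
      (g := ν.1 k) ⟨b * Pi.single (M := fun _ => MvPolynomial σ K) w f k - μ.1 k, ?_⟩
    linear_combination -((hsing k).symm.trans (hcoord k))
  have hμ : ∀ k, b ∣ μ.1 k := by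
    intro k
    refine dvd_of_dvd_mul_sub_of_ne hwv₃ (fun h => hv₃v₁ h.2.symm) (fun h => hwv₃ h.1)
      (g := μ.1 k) ⟨d * Pi.single (M := fun _ => MvPolynomial σ K) w f k - ν.1 k, ?_⟩
    linear_combination -((hsing k).symm.trans (hcoord k))
  choose ν' hν' using hν
  choose μ' hμ' using hμ
  have hsum : ∀ k, Pi.single (M := fun _ => MvPolynomial σ K) w f k = ν' k + μ' k := by
    intro k
    apply mul_left_cancel₀ (mul_ne_zero hb0 hd0)
    rw [← hsing, hcoord, hν', hμ']
    ring
  have hφedge : ∀ {g : σ → MvPolynomial σ K} {i j}, i ∈ s → j ∈ s → X i - X j ∣ g i - g j →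
      φ (g i) = φ (g j) := by
    intro g i j hi hj h
    have := map_dvd φ h
    rwa [map_sub, hφX, hφX, if_pos hi, if_pos hj, sub_self, zero_dvd_iff, map_sub,
      sub_eq_zero] at this
  have hν'eq : φ (ν' w) = φ (ν' v₁) := by
    refine hφedge hsw hsv₁ (dvd_of_dvd_mul_sub_of_ne hwv₃ (fun h => hv₃v₁ h.2.symm)
      (fun h => hwv₃ h.1) ?_)
    have := ν.2 w v₁ hadj
    rwa [hν', hν', ← mul_sub] at this
  have hμ'eq : ∀ i, i < n → φ (μ' (c i)) = φ (μ' w) := by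
    intro i
    induction i with
    | zero => intro _; rfl
    | succ i ih =>
      intro hi
      rw [← ih (by omega)]
      symm
      have hii := hc i (i + 1) (by omega) hi
      have h₁ : ¬ (c i = w ∧ c (i + 1) = v₁) := by
        rintro ⟨h, h'⟩
        rcases Nat.eq_zero_or_pos i with rfl | hi0
        · exact hv₃v₁ h'
        · exact (hc 0 i hi0 (by omega)).1 h.symm
      have h₂ : ¬ (c i = v₁ ∧ c (i + 1) = w) := fun h =>
        (hc 0 (i + 1) (by omega) hi).1 h.2.symm
      refine hφedge (hmem i (by omega)) (hmem _ hi) (dvd_of_dvd_mul_sub_of_ne hwv₁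
        h₁ h₂ ?_)
      have := μ.2 _ _ (hii.2.2 (Or.inl rfl))
      rwa [hμ', hμ', ← mul_sub] at this
  refine hφf ?_
  have h₁ := hsum w
  have h₂ := hsum v₁
  rw [Pi.single_eq_same] at h₁
  rw [Pi.single_eq_of_ne hwv₁.symm] at h₂
  rw [h₁, map_add, hν'eq, ← hμ'eq (n - 1) (by omega), ← map_add, ← h₂, map_zero]

end NotProjective

/-- The vertices `p 0, …, p n` form an induced path of `G`, in this order. -/
def IsInducedPath {V : Type} (G : SimpleGraph V) (p : ℕ → V) (n : ℕ) : Prop :=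
  ∀ i j, i < j → j ≤ n → p i ≠ p j ∧ (G.Adj (p i) (p j) ↔ j = i + 1)

/-- `G` has no induced cycle of length at least five. -/
def HoleFree {V : Type} (G : SimpleGraph V) : Prop :=
  ∀ c n, 5 ≤ n → ¬ IsInducedCycle G c n

section InducedPathsAndCycles

variable {V : Type} {G : SimpleGraph V} {c p : ℕ → V} {n : ℕ}

lemma cycleGraph_adj_iff_of_lt {i j : Fin n} (hij : i < j) :
    (SimpleGraph.cycleGraph n).Adj i j ↔ (j : ℕ) = i + 1 ∨ (i : ℕ) = 0 ∧ (j : ℕ) + 1 = n := by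
  rw [SimpleGraph.cycleGraph_adj', Fin.sub_val_of_le hij.le, Fin.coe_sub_iff_lt.2 hij]
  have := j.2
  rw [Fin.lt_def] at hij
  omega

lemma exists_isInducedCycle_of_hasInducedCycleLen (hn : 0 < n) (h : HasInducedCycleLen G n) :
    ∃ c, IsInducedCycle G c n := by
  obtain ⟨s, ⟨e⟩⟩ := h
  refine ⟨fun i => e.symm ⟨i % n, Nat.mod_lt _ hn⟩, fun i j hij hj => ?_⟩
  have hi : (⟨i % n, Nat.mod_lt _ hn⟩ : Fin n) = ⟨i, hij.trans hj⟩ :=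
    Fin.ext (Nat.mod_eq_of_lt (hij.trans hj))
  have hj' : (⟨j % n, Nat.mod_lt _ hn⟩ : Fin n) = ⟨j, hj⟩ := Fin.ext (Nat.mod_eq_of_lt hj)
  dsimp only
  rw [hi, hj']
  refine ⟨fun h => ?_, ?_⟩
  · have := congrArg Fin.val (e.symm.injective (Subtype.val_injective h))
    simp only at this
    omega
  · rw [← SimpleGraph.induce_adj, e.symm.map_adj_iff, cycleGraph_adj_iff_of_lt hij]

lemma hasInducedCycleLen_of_isInducedCycle (h : IsInducedCycle G c n) :
    HasInducedCycleLen G n := by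
  have hinj : Function.Injective fun i : Fin n => c i := by
    intro i j hij
    rcases lt_trichotomy i j with h' | h' | h'
    · exact absurd hij (h i j h' j.2).1
    · exact h'
    · exact absurd hij.symm (h j i h' i.2).1
  have key : ∀ i j : Fin n, i < j →
      ((SimpleGraph.cycleGraph n).Adj i j ↔ G.Adj (c i) (c j)) := fun i j hij =>
    (cycleGraph_adj_iff_of_lt hij).trans (h i j hij j.2).2.symm
  refine ⟨Set.range fun i : Fin n => c i, ⟨⟨(Equiv.ofInjective _ hinj).symm, ?_⟩⟩⟩
  intro a b
  obtain ⟨i, rfl⟩ := (Equiv.ofInjective _ hinj).surjective a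
  obtain ⟨j, rfl⟩ := (Equiv.ofInjective _ hinj).surjective b
  rw [Equiv.symm_apply_apply, Equiv.symm_apply_apply, SimpleGraph.induce_adj,
    Equiv.ofInjective_apply, Equiv.ofInjective_apply]
  rcases lt_trichotomy i j with h' | rfl | h'
  · exact key i j h'
  · simp
  · rw [SimpleGraph.adj_comm, G.adj_comm]
    exact key j i h'

lemma IsInducedCycle.rotate {k : ℕ} (hk : k < n) (h : IsInducedCycle G c n) :
    IsInducedCycle G (fun i => if i + k < n then c (i + k) else c (i + k - n)) n := by
  intro i j hij hj
  dsimp only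
  split_ifs with h₁ h₂ h₂
  · obtain ⟨h₃, h₄⟩ := h (i + k) (j + k) (by omega) h₂
    exact ⟨h₃, h₄.trans (by omega)⟩
  · obtain ⟨h₃, h₄⟩ := h (j + k - n) (i + k) (by omega) h₁
    exact ⟨h₃.symm, (G.adj_comm _ _).trans (h₄.trans (by omega))⟩
  · omega
  · obtain ⟨h₃, h₄⟩ := h (i + k - n) (j + k - n) (by omega) (by omega)
    exact ⟨h₃, h₄.trans (by omega)⟩

lemma IsInducedPath.reverse (h : IsInducedPath G p n) :
    IsInducedPath G (fun i => p (n - i)) n := by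
  intro i j hij hj
  obtain ⟨h₁, h₂⟩ := h (n - j) (n - i) (by omega) (by omega)
  exact ⟨h₁.symm, (G.adj_comm _ _).trans (h₂.trans (by omega))⟩

lemma IsInducedPath.shift {k m : ℕ} (h : IsInducedPath G p n) (hm : k + m ≤ n) :
    IsInducedPath G (fun i => p (k + i)) m := by
  intro i j hij hj
  obtain ⟨h₁, h₂⟩ := h (k + i) (k + j) (by omega) (by omega)
  exact ⟨h₁, h₂.trans (by omega)⟩

lemma IsInducedPath.cons {t : V} (h : IsInducedPath G p n) (ht : ∀ i ≤ n, t ≠ p i)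
    (ht' : ∀ i ≤ n, (G.Adj t (p i) ↔ i = 0)) :
    IsInducedPath G (fun i => if i = 0 then t else p (i - 1)) (n + 1) := by
  intro i j hij hj
  dsimp only
  rw [if_neg (show j ≠ 0 by omega)]
  split_ifs with h₁
  · exact ⟨ht _ (by omega), (ht' _ (by omega)).trans (by omega)⟩
  · obtain ⟨h₃, h₄⟩ := h (i - 1) (j - 1) (by omega) (by omega)
    exact ⟨h₃, h₄.trans (by omega)⟩

lemma IsInducedPath.isInducedCycle {t : V} (h : IsInducedPath G p n) (ht : ∀ i ≤ n, t ≠ p i)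
    (ht' : ∀ i ≤ n, (G.Adj t (p i) ↔ i = 0 ∨ i = n)) :
    IsInducedCycle G (fun i => if i = 0 then t else p (i - 1)) (n + 2) := by
  intro i j hij hj
  dsimp only
  rw [if_neg (show j ≠ 0 by omega)]
  split_ifs with h₁
  · exact ⟨ht _ (by omega), (ht' _ (by omega)).trans (by omega)⟩
  · obtain ⟨h₃, h₄⟩ := h (i - 1) (j - 1) (by omega) (by omega)
    exact ⟨h₃, h₄.trans (by omega)⟩

lemma HoleFree.adj_one_or_adj_two {t : V} (hG : HoleFree G) (hn : 2 ≤ n) (h : IsInducedPath G p n)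
    (ht : ∀ i ≤ n, t ≠ p i) (h₀ : G.Adj t (p 0)) (h₁ : G.Adj t (p n)) :
    G.Adj t (p 1) ∨ G.Adj t (p 2) := by
  classical
  by_contra! hcon
  have hex : ∃ j, 1 ≤ j ∧ G.Adj t (p j) := ⟨n, by omega, h₁⟩
  set j := Nat.find hex with hj
  have hjn : j ≤ n := Nat.find_min' hex ⟨by omega, h₁⟩
  obtain ⟨hj1, hjadj⟩ := Nat.find_spec hex
  rw [← hj] at hj1 hjadj
  have hj3 : 3 ≤ j := by
    by_contra hlt
    have : j = 1 ∨ j = 2 := by omega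
    rcases this with h | h
    · exact hcon.1 (h ▸ hjadj)
    · exact hcon.2 (h ▸ hjadj)
  have hsub : IsInducedPath G p j := fun a b hab hb => h a b hab (hb.trans hjn)
  refine hG _ (j + 2) (by omega) (hsub.isInducedCycle (fun i hi => ht i (hi.trans hjn)) ?_)
  intro i hi
  refine ⟨fun hadj => ?_, ?_⟩
  · by_contra hne
    exact Nat.find_min hex (m := i) (by omega) ⟨by omega, hadj⟩
  · rintro (rfl | rfl)
    · exact h₀
    · exact hjadj

end InducedPathsAndCycles

/-- Any two vertices of `T` are joined by a path of `G` inside `T`. -/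
def ConnectedOn {V : Type} (G : SimpleGraph V) (T : Set V) : Prop :=
  ∀ a ∈ T, ∀ b ∈ T, Relation.ReflTransGen (fun x y => x ∈ T ∧ y ∈ T ∧ G.Adj x y) a b

section ConnectedOn

variable {V : Type} {G : SimpleGraph V} {T : Set V}

lemma connectedOn_singleton (v : V) : ConnectedOn G {v} := by
  rintro a rfl b rfl
  exact .refl

lemma ConnectedOn.insert_of_adj {t v : V} (hT : ConnectedOn G T) (ht : t ∈ T) (hv : G.Adj t v) :
    ConnectedOn G (insert v T) := by
  have key : ∀ a ∈ T, ∀ b ∈ T,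
      Relation.ReflTransGen (fun x y => x ∈ insert v T ∧ y ∈ insert v T ∧ G.Adj x y) a b :=
    fun a ha b hb => Relation.ReflTransGen.mono
      (fun x y h => ⟨Or.inr h.1, Or.inr h.2.1, h.2.2⟩) a b (hT a ha b hb)
  rintro a (rfl | ha) b (rfl | hb)
  · exact .refl
  · exact .head ⟨Or.inl rfl, Or.inr ht, hv.symm⟩ (key t ht b hb)
  · exact .tail (key a ha t ht) ⟨Or.inr ht, Or.inl rfl, hv⟩
  · exact key a ha b hb

lemma exists_seq_of_reflTransGen {r : V → V → Prop} {a b : V} (h : Relation.ReflTransGen r a b) :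
    ∃ (k : ℕ) (q : ℕ → V), q 0 = a ∧ q k = b ∧ ∀ i < k, r (q i) (q (i + 1)) := by
  induction h using Relation.ReflTransGen.head_induction_on with
  | refl => exact ⟨0, fun _ => b, rfl, rfl, fun i hi => absurd hi (Nat.not_lt_zero i)⟩
  | @head a c hac _ ih =>
    obtain ⟨k, q, h0, hk, hq⟩ := ih
    refine ⟨k + 1, fun i => if i = 0 then a else q (i - 1), by simp, by simpa using hk, ?_⟩
    intro i hi
    rcases Nat.eq_zero_or_pos i with rfl | hi0
    · simpa [h0] using hac
    · have := hq (i - 1) (by omega)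
      rw [Nat.sub_add_cancel hi0] at this
      simpa [hi0.ne'] using this

lemma ConnectedOn.exists_isInducedPath {A B : Set V} {a b : V} (hT : ConnectedOn G T)
    (ha : a ∈ T) (haA : a ∈ A) (hb : b ∈ T) (hbB : b ∈ B) :
    ∃ (q : ℕ → V) (k : ℕ), IsInducedPath G q k ∧ (∀ i ≤ k, q i ∈ T) ∧ q 0 ∈ A ∧ q k ∈ B ∧
      (∀ i ≤ k, q i ∈ A → i = 0) ∧ ∀ i ≤ k, q i ∈ B → i = k := by
  classical
  set Good : ℕ → (ℕ → V) → Prop := fun k q =>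
    (∀ i ≤ k, q i ∈ T) ∧ q 0 ∈ A ∧ q k ∈ B ∧ ∀ i < k, G.Adj (q i) (q (i + 1)) with hGood
  have hex : ∃ k q, Good k q := by
    obtain ⟨k, q, h0, hk, hq⟩ := exists_seq_of_reflTransGen (hT a ha b hb)
    refine ⟨k, q, fun i hi => ?_, h0 ▸ haA, hk ▸ hbB, fun i hi => (hq i hi).2.2⟩
    rcases hi.lt_or_eq with hi | rfl
    · exact (hq i hi).1
    · exact hk ▸ hb
  obtain ⟨q, hqT, hqA, hqB, hq⟩ := Nat.find_spec hex
  set k := Nat.find hex with hk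
  have hmin : ∀ m q', Good m q' → k ≤ m := fun m q' h => Nat.find_min' hex ⟨q', h⟩
  refine ⟨q, k, fun i j hij hj => ⟨fun h => ?_, fun h => ?_, fun h => h ▸ hq i (by omega)⟩,
    hqT, hqA, hqB, fun i hi h => ?_, fun i hi h => ?_⟩
  · have := hmin (k - (j - i)) (fun m => if m ≤ i then q m else q (m + (j - i)))
      ⟨fun m hm => ?_, by simpa using hqA, ?_, fun m hm => ?_⟩
    · omega
    · dsimp only
      split_ifs
      · exact hqT m (by omega)
      · exact hqT _ (by omega)
    · dsimp only
      split_ifs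
      · rw [show k - (j - i) = i by omega, h, show j = k by omega]
        exact hqB
      · rw [show k - (j - i) + (j - i) = k by omega]
        exact hqB
    · dsimp only
      split_ifs with h₁ h₂ h₂
      · exact hq m (by omega)
      · rw [show m = i by omega, h, show i + 1 + (j - i) = j + 1 by omega]
        exact hq j (by omega)
      · omega
      · rw [show m + 1 + (j - i) = m + (j - i) + 1 by omega]
        exact hq _ (by omega)
  · by_contra hne
    have := hmin (k - (j - i - 1)) (fun m => if m ≤ i then q m else q (m + (j - i - 1)))
      ⟨fun m hm => ?_, by simpa using hqA, ?_, fun m hm => ?_⟩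
    · omega
    · dsimp only
      split_ifs
      · exact hqT m (by omega)
      · exact hqT _ (by omega)
    · dsimp only
      rw [if_neg (by omega), show k - (j - i - 1) + (j - i - 1) = k by omega]
      exact hqB
    · dsimp only
      split_ifs with h₁ h₂ h₂
      · exact hq m (by omega)
      · rw [show m = i by omega, show i + 1 + (j - i - 1) = j by omega]
        exact h
      · omega
      · rw [show m + 1 + (j - i - 1) = m + (j - i - 1) + 1 by omega]
        exact hq _ (by omega)
  · have := hmin (k - i) (fun m => q (m + i)) ⟨fun m hm => hqT _ (by omega), by simpa using h, ?_,
      fun m hm => ?_⟩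
    · omega
    · dsimp only
      rwa [Nat.sub_add_cancel hi]
    · dsimp only
      rw [show m + 1 + i = m + i + 1 by omega]
      exact hq _ (by omega)
  · have := hmin i q ⟨fun m hm => hqT _ (by omega), hqA, h, fun m hm => hq _ (by omega)⟩
    omega

end ConnectedOn

section TwoPair

variable {V : Type} {G : SimpleGraph V}

lemma exists_complete_of_connectedOn_compl (hG : HoleFree G) (hGc : HoleFree Gᶜ) {p : ℕ → V}
    {n : ℕ} (hn : 3 ≤ n) (hp : IsInducedPath G p n) {T : Set V} (hT : ConnectedOn Gᶜ T)
    (hpT : ∀ i ≤ n, p i ∉ T) (h₀ : ∀ t ∈ T, G.Adj t (p 0)) (h₁ : ∀ t ∈ T, G.Adj t (p n)) :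
    (∀ t ∈ T, G.Adj t (p 1)) ∨ ∀ t ∈ T, G.Adj t (p 2) := by
  have hne : ∀ t ∈ T, ∀ i ≤ n, t ≠ p i := fun t ht i hi h => hpT i hi (h ▸ ht)
  by_contra! hcon
  obtain ⟨⟨a, ha, ha'⟩, b, hb, hb'⟩ := hcon
  have hor : ∀ t ∈ T, G.Adj t (p 1) ∨ G.Adj t (p 2) := fun t ht =>
    hG.adj_one_or_adj_two (by omega) hp (hne t ht) (h₀ t ht) (h₁ t ht)
  obtain ⟨q, k, hq, hqT, hqA, hqB, hA, hB⟩ := hT.exists_isInducedPath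
    (A := {t | ¬ G.Adj t (p 1)}) (B := {t | ¬ G.Adj t (p 2)}) ha ha' hb hb'
  have hk : k ≠ 0 := by
    rintro rfl
    exact (hor _ (hqT 0 le_rfl)).elim hqA hqB
  have hpath₁ := hq.cons (t := p 1) (fun i hi => (hne _ (hqT i hi) 1 (by omega)).symm) (by
    intro i hi
    rw [SimpleGraph.compl_adj, G.adj_comm]
    refine ⟨fun h => hA i hi h.2, ?_⟩
    rintro rfl
    exact ⟨(hne _ (hqT 0 hi) 1 (by omega)).symm, hqA⟩)
  have hpath₂ := hpath₁.reverse.cons (t := p 2) (by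
    intro i hi
    split_ifs with h
    · exact (hp 1 2 (by omega) (by omega)).1.symm
    · exact (hne _ (hqT _ (by omega)) 2 (by omega)).symm) (by
    intro i hi
    rw [SimpleGraph.compl_adj, G.adj_comm]
    split_ifs with h
    · have := (hp 1 2 (by omega) (by omega)).2.2 rfl
      exact ⟨fun h => absurd this h.2, fun h => by omega⟩
    · refine ⟨fun h => ?_, ?_⟩
      · have := hB _ (by omega) h.2
        omega
      · rintro rfl
        exact ⟨(hne _ (hqT _ (by omega)) 2 (by omega)).symm, hqB⟩)
  have hnot : ∀ i j, i < j → j ≤ n → j ≠ i + 1 → Gᶜ.Adj (p j) (p i) := by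
    intro i j hij hj h
    rw [Gᶜ.adj_comm, SimpleGraph.compl_adj]
    exact ⟨(hp i j hij hj).1, fun h' => h ((hp i j hij hj).2.1 h')⟩
  rcases hn.eq_or_lt with rfl | hn
  · have hpath₃ := hpath₂.cons (t := p 0) (by
      intro i hi
      split_ifs with h h'
      · exact (hp 0 2 (by omega) (by omega)).1
      · exact (hp 0 1 (by omega) (by omega)).1
      · exact (hne _ (hqT _ (by omega)) 0 (by omega)).symm) (by
      intro i hi
      split_ifs with h h'
      · exact ⟨fun _ => h, fun _ => (hnot 0 2 (by omega) (by omega) (by omega)).symm⟩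
      · have := (hp 0 1 (by omega) (by omega)).2.2 rfl
        exact ⟨fun h => absurd this ((SimpleGraph.compl_adj _ _ _).1 h).2, fun h => by omega⟩
      · have := (h₀ _ (hqT (k + 1 - (i - 1) - 1) (by omega))).symm
        exact ⟨fun h => absurd this ((SimpleGraph.compl_adj _ _ _).1 h).2, fun h => by omega⟩)
    refine hGc _ _ ?_ (hpath₃.isInducedCycle (t := p 3) ?_ ?_)
    · omega
    · intro i hi
      split_ifs with h h' h''
      · exact (hp 0 3 (by omega) (by omega)).1.symm
      · exact (hp 2 3 (by omega) (by omega)).1.symm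
      · exact (hp 1 3 (by omega) (by omega)).1.symm
      · exact (hne _ (hqT _ (by omega)) 3 (by omega)).symm
    · intro i hi
      split_ifs with h h' h''
      · exact ⟨fun _ => Or.inl h, fun _ => hnot 0 3 (by omega) (by omega) (by omega)⟩
      · have := (hp 2 3 (by omega) (by omega)).2.2 rfl
        exact ⟨fun h => absurd this.symm ((SimpleGraph.compl_adj _ _ _).1 h).2, fun h => by omega⟩
      · exact ⟨fun _ => Or.inr (by omega), fun _ => hnot 1 3 (by omega) (by omega) (by omega)⟩
      · have := (h₁ _ (hqT (k + 1 - (i - 1 - 1) - 1) (by omega))).symm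
        exact ⟨fun h => absurd this ((SimpleGraph.compl_adj _ _ _).1 h).2, fun h => by omega⟩
  · refine hGc _ _ ?_ (hpath₂.isInducedCycle (t := p n) ?_ ?_)
    · omega
    · intro i hi
      split_ifs with h h'
      · exact (hp 2 n (by omega) (by omega)).1.symm
      · exact (hp 1 n (by omega) (by omega)).1.symm
      · exact (hne _ (hqT _ (by omega)) n (by omega)).symm
    · intro i hi
      split_ifs with h h'
      · exact ⟨fun _ => Or.inl h, fun _ => hnot 2 n (by omega) (by omega) (by omega)⟩
      · exact ⟨fun _ => Or.inr (by omega), fun _ => hnot 1 n (by omega) (by omega) (by omega)⟩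
      · have := (h₁ _ (hqT (k + 1 - (i - 1) - 1) (by omega))).symm
        exact ⟨fun h => absurd this ((SimpleGraph.compl_adj _ _ _).1 h).2, fun h => by omega⟩

/-- The induced paths of `G` joining `x` to `y` inside `U` have length at most two. -/
def NoLongPath {V : Type} (G : SimpleGraph V) (U : Set V) (x y : V) : Prop :=
  ∀ p n, 3 ≤ n → IsInducedPath G p n → p 0 = x → p n = y → ¬ ∀ i ≤ n, p i ∈ U

lemma NoLongPath.symm {U : Set V} {x y : V} (h : NoLongPath G U x y) : NoLongPath G U y x := by
  intro p n hn hp h₀ h₁ hU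
  exact h _ n hn hp.reverse (by simpa using h₁) (by simpa using h₀) fun i _ => hU _ (by omega)

lemma exists_noLongPath (hG : HoleFree G) (hGc : HoleFree Gᶜ) (U : Finset V) {x₀ y₀ : V}
    (hx₀ : x₀ ∈ U) (hy₀ : y₀ ∈ U) (h₀ : Gᶜ.Adj x₀ y₀) :
    ∃ x ∈ U, ∃ y ∈ U, Gᶜ.Adj x y ∧ NoLongPath G (U : Set V) x y := by
  classical
  induction U using Finset.strongInduction generalizing x₀ y₀ with
  | H U ih =>
  set C : Finset V → Finset V := fun T => {v ∈ U | ∀ t ∈ T, G.Adj t v} with hC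
  have hmemC : ∀ {T v}, v ∈ C T ↔ v ∈ U ∧ ∀ t ∈ T, G.Adj t v := by simp [hC]
  set 𝒯 : Finset (Finset V) := {T ∈ U.powerset | T.Nonempty ∧ ConnectedOn Gᶜ (T : Set V) ∧
    ∃ x ∈ C T, ∃ y ∈ C T, Gᶜ.Adj x y} with h𝒯
  have hmem : ∀ {T}, T ∈ 𝒯 ↔ T ⊆ U ∧ T.Nonempty ∧ ConnectedOn Gᶜ (T : Set V) ∧
    ∃ x ∈ C T, ∃ y ∈ C T, Gᶜ.Adj x y := by simp [h𝒯]
  have hnot : ∀ {p : ℕ → V} {n i j}, IsInducedPath G p n → i + 1 < j → j ≤ n →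
      Gᶜ.Adj (p i) (p j) := by
    intro p n i j hp hij hj
    obtain ⟨h₁, h₂⟩ := hp i j (by omega) hj
    exact (SimpleGraph.compl_adj _ _ _).2 ⟨h₁, fun h => by have := h₂.1 h; omega⟩
  rcases 𝒯.eq_empty_or_nonempty with hemp | hnon
  · refine ⟨x₀, hx₀, y₀, hy₀, h₀, fun p n hn hp _ _ hU => ?_⟩
    have : ({p 1} : Finset V) ∈ 𝒯 := by
      refine hmem.2 ⟨by simpa using hU 1 (by omega), by simp, ?_, p 0, ?_, p 2, ?_,
        hnot hp (by omega) (by omega)⟩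
      · simpa using connectedOn_singleton (G := Gᶜ) (p 1)
      · refine hmemC.2 ⟨hU 0 (by omega), ?_⟩
        simpa using ((hp 0 1 (by omega) (by omega)).2.2 rfl).symm
      · refine hmemC.2 ⟨hU 2 (by omega), ?_⟩
        simpa using (hp 1 2 (by omega) (by omega)).2.2 rfl
    rw [hemp] at this
    exact absurd this (Finset.notMem_empty _)
  · obtain ⟨T, hT𝒯, hmax⟩ := 𝒯.exists_max_image Finset.card hnon
    obtain ⟨hTU, ⟨t₀, ht₀⟩, hT, x₁, hx₁, y₁, hy₁, h₁⟩ := hmem.1 hT𝒯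
    have hlt : C T ⊂ U := by
      refine Finset.ssubset_iff_subset_ne.2 ⟨Finset.filter_subset _ _, fun h => ?_⟩
      have : t₀ ∈ C T := h ▸ hTU ht₀
      exact ((hmemC.1 this).2 t₀ ht₀).ne rfl
    obtain ⟨x, hx, y, hy, hxy, hpath⟩ := ih (C T) hlt hx₁ hy₁ h₁
    refine ⟨x, (hmemC.1 hx).1, y, (hmemC.1 hy).1, hxy, fun p n hn hp h0 hn' hU => ?_⟩
    have hp0 : p 0 ∈ C T := h0 ▸ hx
    have hpn : p n ∈ C T := hn' ▸ hy
    have hpT : ∀ i ≤ n, p i ∉ T := by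
      intro i hi h
      have h₁ := (hmemC.1 hp0).2 _ h
      have h₂ := (hmemC.1 hpn).2 _ h
      have hi0 : i ≠ 0 := fun h => by rw [h] at h₁; exact h₁.ne rfl
      have hin : i ≠ n := fun h => by rw [h] at h₂; exact h₂.ne rfl
      have := (hp 0 i (by omega) hi).2.1 h₁.symm
      have := (hp i n (by omega) le_rfl).2.1 h₂
      omega
    have hex : ∃ i, i ≤ n ∧ p i ∉ C T := by
      by_contra! hall
      exact hpath p n hn hp h0 hn' hall
    set i := Nat.find hex with hi
    obtain ⟨hin, hiC⟩ := Nat.find_spec hex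
    rw [← hi] at hin hiC
    have hi0 : i ≠ 0 := fun h => hiC (h ▸ hp0)
    have hine : i ≠ n := fun h => hiC (h ▸ hpn)
    have hprev : p (i - 1) ∈ C T := by
      by_contra h
      exact Nat.find_min hex (m := i - 1) (by omega) ⟨by omega, h⟩
    have hex' : ∃ j, i + 1 ≤ j ∧ p j ∈ C T := ⟨n, by omega, hpn⟩
    set j := Nat.find hex' with hj
    obtain ⟨hij, hjC⟩ := Nat.find_spec hex'
    rw [← hj] at hij hjC
    have hjn : j ≤ n := Nat.find_min' hex' ⟨by omega, hpn⟩
    have hnext : p (i + 1) ∈ C T := by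
      by_contra h
      have hj3 : i + 2 ≤ j := by
        rcases hij.eq_or_lt with h' | h'
        · exact absurd (h' ▸ hjC) h
        · exact h'
      rcases exists_complete_of_connectedOn_compl hG hGc (n := j - (i - 1)) (by omega)
        (hp.shift (k := i - 1) (by omega)) hT (fun m hm => hpT _ (by omega))
        (hmemC.1 hprev).2 (by
          rw [show i - 1 + (j - (i - 1)) = j by omega]
          exact (hmemC.1 hjC).2) with h' | h'
      · rw [show i - 1 + 1 = i by omega] at h'
        exact hiC (hmemC.2 ⟨hU i hin, h'⟩)
      · rw [show i - 1 + 2 = i + 1 by omega] at h'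
        exact h (hmemC.2 ⟨hU (i + 1) (by omega), h'⟩)
    obtain ⟨t, ht, hti⟩ : ∃ t ∈ T, ¬ G.Adj t (p i) := by
      by_contra! hall
      exact hiC (hmemC.2 ⟨hU i hin, hall⟩)
    have hbig : insert (p i) T ∈ 𝒯 := by
      refine hmem.2 ⟨Finset.insert_subset (hU i hin) hTU, Finset.insert_nonempty _ _, ?_,
        p (i - 1), ?_, p (i + 1), ?_, hnot hp (by omega) (by omega)⟩
      · rw [Finset.coe_insert]
        exact hT.insert_of_adj ht ((SimpleGraph.compl_adj _ _ _).2
          ⟨fun h => hpT i hin (h ▸ ht), hti⟩)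
      · refine hmemC.2 ⟨hU _ (by omega), Finset.forall_mem_insert _ _ _ |>.2
          ⟨?_, (hmemC.1 hprev).2⟩⟩
        exact ((hp (i - 1) i (by omega) hin).2.2 (by omega)).symm
      · refine hmemC.2 ⟨hU _ (by omega), Finset.forall_mem_insert _ _ _ |>.2
          ⟨?_, (hmemC.1 hnext).2⟩⟩
        exact (hp i (i + 1) (by omega) (by omega)).2.2 rfl
    have := hmax _ hbig
    rw [Finset.card_insert_of_notMem (hpT i hin)] at this
    omega

lemma holeFree_compl_deleteEdges {x y : V} (hGc : HoleFree Gᶜ) (hxy : G.Adj x y)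
    (h : NoLongPath Gᶜ Set.univ x y) : HoleFree (G.deleteEdges {s(x, y)})ᶜ := by
  have hadj : ∀ u v, (G.deleteEdges {s(x, y)})ᶜ.Adj u v ↔
      Gᶜ.Adj u v ∨ u = x ∧ v = y ∨ u = y ∧ v = x := by
    intro u v
    simp only [SimpleGraph.compl_adj, SimpleGraph.deleteEdges_adj, Set.mem_singleton_iff,
      Sym2.eq_iff]
    constructor
    · tauto
    · rintro (h | ⟨rfl, rfl⟩ | ⟨rfl, rfl⟩)
      · tauto
      · exact ⟨hxy.ne, by tauto⟩
      · exact ⟨hxy.ne.symm, by tauto⟩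
  have hnot : ¬ Gᶜ.Adj x y := fun h => ((SimpleGraph.compl_adj _ _ _).1 h).2 hxy
  have key : ∀ c n, 5 ≤ n → IsInducedCycle (G.deleteEdges {s(x, y)})ᶜ c n →
      ¬ (c 0 = x ∧ c (n - 1) = y ∨ c 0 = y ∧ c (n - 1) = x) := by
    intro c n hn hc hends
    have hpath : IsInducedPath Gᶜ c (n - 1) := by
      intro i j hij hj
      obtain ⟨h₁, h₂⟩ := hc i j hij (by omega)
      refine ⟨h₁, ?_⟩
      rw [hadj] at h₂
      by_cases h' : i = 0 ∧ j = n - 1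
      · rw [h'.1, h'.2]
        refine ⟨fun h => ?_, fun h => by omega⟩
        rcases hends with h' | h'
        · rw [h'.1, h'.2] at h
          exact absurd h hnot
        · rw [h'.1, h'.2] at h
          exact absurd h.symm hnot
      · rw [← or_iff_left (a := Gᶜ.Adj (c i) (c j)) (b := c i = x ∧ c j = y ∨ c i = y ∧ c j = x),
          h₂]
        · omega
        · intro hends'
          have hi : c i = c 0 ∨ c i = c (n - 1) := by
            rcases hends with h | h <;> rcases hends' with h' | h' <;>
              simp [h.1, h.2, h'.1]
          have hj' : c j = c 0 ∨ c j = c (n - 1) := by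
            rcases hends with h | h <;> rcases hends' with h' | h' <;>
              simp [h.1, h.2, h'.2]
          have hi0 : i = 0 := by
            by_contra hi0
            rcases hi with h | h
            · exact (hc 0 i (by omega) (by omega)).1 h.symm
            · exact (hc i (n - 1) (by omega) (by omega)).1 h
          have hjn : j = n - 1 := by
            by_contra hjn
            rcases hj' with h | h
            · exact (hc 0 j (by omega) (by omega)).1 h.symm
            · exact (hc j (n - 1) (by omega) (by omega)).1 h
          exact h' ⟨hi0, hjn⟩
    rcases hends with h' | h'
    · exact h c (n - 1) (by omega) hpath h'.1 h'.2 fun _ _ => trivial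
    · exact h.symm c (n - 1) (by omega) hpath h'.1 h'.2 fun _ _ => trivial
  intro c n hn hc
  refine hGc c n hn fun i j hij hj => ?_
  obtain ⟨h₁, h₂⟩ := hc i j hij hj
  refine ⟨h₁, ?_⟩
  rw [← h₂, hadj]
  refine (or_iff_left fun hends => ?_).symm
  have h₃ := h₂.1 ((hadj _ _).2 (Or.inr hends))
  rcases h₃ with h₃ | h₃
  · refine key _ n hn (hc.rotate hj) ?_
    rw [if_pos (by omega), if_neg (by omega), zero_add, show n - 1 + j - n = i by omega]
    tauto
  · rw [h₃.1, show j = n - 1 by omega] at hends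
    exact key c n hn hc hends

lemma holeFree_deleteEdges {x y : V} (hG : HoleFree G) (hxy : G.Adj x y)
    (h : NoLongPath Gᶜ Set.univ x y) : HoleFree (G.deleteEdges {s(x, y)}) := by
  have hadj : ∀ u v, (G.deleteEdges {s(x, y)}).Adj u v ↔
      G.Adj u v ∧ ¬ (u = x ∧ v = y ∨ u = y ∧ v = x) := by
    intro u v
    simp only [SimpleGraph.deleteEdges_adj, Set.mem_singleton_iff, Sym2.eq_iff]
  have key : ∀ c n k, 5 ≤ n → IsInducedCycle (G.deleteEdges {s(x, y)}) c n → 0 < k → k < n →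
      ¬ (c 0 = x ∧ c k = y ∨ c 0 = y ∧ c k = x) := by
    intro c n k hn hc hk hkn hends
    have hinj : ∀ {i j}, i < n → j < n → c i = c j → i = j := by
      intro i j hi hj hij
      rcases lt_trichotomy i j with h | h | h
      · exact absurd hij (hc i j h hj).1
      · exact h
      · exact absurd hij.symm (hc j i h hi).1
    have hiff : ∀ i j, i < n → j < n → ((c i = x ∧ c j = y ∨ c i = y ∧ c j = x) ↔
        (i = 0 ∧ j = k ∨ i = k ∧ j = 0)) := by
      intro i j hi hj
      constructor
      · intro h'
        rcases hends with h | h <;> rcases h' with h' | h'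
        · exact Or.inl ⟨hinj hi (by omega) (h'.1.trans h.1.symm), hinj hj hkn (h'.2.trans h.2.symm)⟩
        · exact Or.inr ⟨hinj hi hkn (h'.1.trans h.2.symm), hinj hj (by omega) (h'.2.trans h.1.symm)⟩
        · exact Or.inr ⟨hinj hi hkn (h'.1.trans h.2.symm), hinj hj (by omega) (h'.2.trans h.1.symm)⟩
        · exact Or.inl ⟨hinj hi (by omega) (h'.1.trans h.1.symm), hinj hj hkn (h'.2.trans h.2.symm)⟩
      · rintro (⟨rfl, rfl⟩ | ⟨rfl, rfl⟩)
        · exact hends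
        · tauto
    have hGadj : ∀ i j, i < j → j < n →
        (G.Adj (c i) (c j) ↔ j = i + 1 ∨ i = 0 ∧ j + 1 = n ∨ i = 0 ∧ j = k) := by
      intro i j hij hj
      have h₁ := (hc i j hij hj).2
      rw [hadj, hiff i j (by omega) hj] at h₁
      by_cases h' : i = 0 ∧ j = k
      · rw [h'.1, h'.2]
        refine ⟨fun _ => Or.inr (Or.inr ⟨rfl, rfl⟩), fun _ => ?_⟩
        rcases hends with h | h
        · rw [h.1, h.2]; exact hxy
        · rw [h.1, h.2]; exact hxy.symm
      · rw [← and_iff_left (a := G.Adj (c i) (c j)) (b := ¬ (i = 0 ∧ j = k ∨ i = k ∧ j = 0)),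
          h₁]
        · omega
        · omega
    have hk₁ : k ≠ 1 ∧ k + 1 ≠ n := by
      have h₁ := (hc 0 k hk hkn).2
      rw [hadj, hiff 0 k (by omega) hkn] at h₁
      omega
    have hk₃ : k ≤ 3 := by
      by_contra hlt
      refine hG c (k + 1) (by omega) fun i j hij hj => ⟨(hc i j hij (by omega)).1, ?_⟩
      rw [hGadj i j hij (by omega)]
      omega
    have hnk₃ : n - k ≤ 3 := by
      by_contra hlt
      refine hG (fun i => if i + k < n then c (i + k) else c 0) (n - k + 1) (by omega)
        fun i j hij hj => ?_
      dsimp only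
      rw [if_pos (by omega)]
      split_ifs with h'
      · refine ⟨(hc _ _ (by omega) h').1, ?_⟩
        rw [hGadj _ _ (by omega) h']
        omega
      · refine ⟨(hc 0 (i + k) (by omega) (by omega)).1.symm, ?_⟩
        rw [G.adj_comm, hGadj _ _ (by omega) (by omega)]
        omega
    have hcompl : ∀ i j, i < n → j < n → i ≠ j → c i ≠ c j ∧ (Gᶜ.Adj (c i) (c j) ↔
        ¬ (j = i + 1 ∨ i = j + 1 ∨ i = 0 ∧ j + 1 = n ∨ j = 0 ∧ i + 1 = n ∨
          i = 0 ∧ j = k ∨ j = 0 ∧ i = k)) := by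
      intro i j hi hj hij
      have hne : c i ≠ c j := fun h => hij (hinj hi hj h)
      refine ⟨hne, ?_⟩
      rw [SimpleGraph.compl_adj, and_iff_right hne]
      refine not_congr ?_
      rcases hij.lt_or_gt with h' | h'
      · rw [hGadj i j h' hj]
        omega
      · rw [G.adj_comm, hGadj j i h' hi]
        omega
    have hno : ∀ (p : ℕ → ℕ) (m : ℕ), 3 ≤ m → IsInducedPath Gᶜ (fun i => c (p i)) m →
        p 0 = 0 → p m = k → False := by
      intro p m hm hp h0 hmk
      rcases hends with h' | h'
      · exact h _ m hm hp (by simpa [h0] using h'.1) (by simpa [hmk] using h'.2) fun _ _ => trivial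
      · exact h.symm _ m hm hp (by simpa [h0] using h'.1) (by simpa [hmk] using h'.2)
          fun _ _ => trivial
    have hcases : n = 5 ∧ k = 2 ∨ n = 5 ∧ k = 3 ∨ n = 6 ∧ k = 3 := by omega
    rcases hcases with ⟨rfl, rfl⟩ | ⟨rfl, rfl⟩ | ⟨rfl, rfl⟩
    · refine hno (fun i => [0, 3, 1, 4, 2].getD i 0) 4 (by omega) (fun i j hij hj => ?_) rfl rfl
      interval_cases j <;> interval_cases i <;>
        exact (hcompl _ _ (by decide) (by decide) (by decide)).imp id fun h => h.trans (by decide)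
    · refine hno (fun i => [0, 2, 4, 1, 3].getD i 0) 4 (by omega) (fun i j hij hj => ?_) rfl rfl
      interval_cases j <;> interval_cases i <;>
        exact (hcompl _ _ (by decide) (by decide) (by decide)).imp id fun h => h.trans (by decide)
    · refine hno (fun i => [0, 2, 5, 3].getD i 0) 3 (by omega) (fun i j hij hj => ?_) rfl rfl
      interval_cases j <;> interval_cases i <;>
        exact (hcompl _ _ (by decide) (by decide) (by decide)).imp id fun h => h.trans (by decide)
  intro c n hn hc
  refine hG c n hn fun i j hij hj => ?_
  obtain ⟨h₁, h₂⟩ := hc i j hij hj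
  refine ⟨h₁, ?_⟩
  rw [← h₂, hadj]
  refine (and_iff_left fun hends => ?_).symm
  refine key _ n (j - i) hn (hc.rotate (k := i) (by omega)) (by omega) (by omega) ?_
  rw [if_pos (by omega), if_pos (by omega), zero_add, Nat.sub_add_cancel hij.le]
  exact hends

lemma exists_edge_of_holeFree [Fintype V] (hG : HoleFree G) (hGc : HoleFree Gᶜ) (hne : G ≠ ⊥) :
    ∃ a b, G.Adj a b ∧
      (∀ u v, G.Adj a u → G.Adj b v → u ≠ b → v ≠ a → ¬ G.Adj b u → ¬ G.Adj a v → G.Adj u v) ∧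
      HoleFree (G.deleteEdges {s(a, b)}) ∧ HoleFree (G.deleteEdges {s(a, b)})ᶜ := by
  obtain ⟨a₀, b₀, h₀⟩ := SimpleGraph.ne_bot_iff_exists_adj.1 hne
  obtain ⟨a, -, b, -, hab, hpath⟩ := exists_noLongPath hGc (by rwa [compl_compl]) Finset.univ
    (Finset.mem_univ a₀) (Finset.mem_univ b₀) (by rwa [compl_compl])
  rw [compl_compl] at hab
  rw [Finset.coe_univ] at hpath
  refine ⟨a, b, hab, fun u v hau hbv hub hva hbu hav => ?_, holeFree_deleteEdges hG hab hpath,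
    holeFree_compl_deleteEdges hGc hab hpath⟩
  by_contra huv
  have huv' : v ≠ u := fun h => hav (h ▸ hau)
  refine hpath (fun i => [a, v, u, b].getD i a) 3 le_rfl (fun i j hij hj => ?_) rfl rfl
    fun _ _ => trivial
  rw [SimpleGraph.compl_adj]
  interval_cases j <;> interval_cases i <;>
    simp [hva.symm, hau.ne, hab.ne, huv', hbv.ne.symm, hub, hau, hab, hbv.symm, hav, huv,
      G.adj_comm v u, G.adj_comm u b, hbu]

end TwoPair

section Main

lemma hasProjectiveDimensionLT_logVec {σ K : Type} [Fintype σ] [Field K] {G : SimpleGraph σ}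
    (hG : HoleFree G) (hGc : HoleFree Gᶜ) :
    HasProjectiveDimensionLT (ModuleCat.of (MvPolynomial σ K) (logVec K G)) 2 := by
  classical
  induction G using WellFoundedLT.induction with
  | ind G ih =>
  rcases eq_or_ne G ⊥ with rfl | hne
  · rw [logVec_bot]
    have : Module.Projective (MvPolynomial σ K)
        (⊤ : Submodule (MvPolynomial σ K) (σ → MvPolynomial σ K)) :=
      Module.Projective.of_equiv Submodule.topEquiv.symm
    have := hasProjectiveDimensionLT_one_of_projective (MvPolynomial σ K)
      (⊤ : Submodule (MvPolynomial σ K) (σ → MvPolynomial σ K))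
    exact hasProjectiveDimensionLT_of_ge _ 1 2 (by omega)
  · obtain ⟨a, b, hab, hN, h₁, h₂⟩ := exists_edge_of_holeFree hG hGc hne
    refine hasProjectiveDimensionLT_logVec_of_edge hab hN (ih _ ?_ h₁ h₂)
    refine lt_of_le_of_ne (G.deleteEdges_le _) fun h => ?_
    have : (G.deleteEdges {s(a, b)}).Adj a b := by rw [h]; exact hab
    simp at this

/-- A logarithmic derivation is determined by its values on the variables. -/
noncomputable def logDerEquiv (ℓ : ℕ) (G : SimpleGraph (Fin ℓ)) :
    logDer ℓ G ≃ₗ[Spoly ℓ] logVec ℚ G where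
  toFun θ := ⟨fun i => θ.1 (X i), θ.2⟩
  map_add' _ _ := rfl
  map_smul' _ _ := rfl
  invFun f := ⟨mkDerivation ℚ f.1, fun i j hij => by
    rw [mkDerivation_X, mkDerivation_X]
    exact f.2 i j hij⟩
  left_inv θ := by
    ext i : 2
    exact mkDerivation_X _ _ _
  right_inv f := by
    ext i : 2
    exact mkDerivation_X _ _ _

end Main

/-- If `G` is weakly chordal but not chordal then the projective dimension of
`D(A(G))` is exactly 1. -/
theorem pd_eq_one_of_weaklyChordal_not_chordal (ℓ : ℕ) (hℓ : 1 ≤ ℓ)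
    (G : SimpleGraph (Fin ℓ)) (hG : WeaklyChordal G) (hG' : ¬ Chordal G) :
    pd (ModuleCat.of (Spoly ℓ) (logDer ℓ G)) = 1 := by

  have hholeFree : ∀ H : SimpleGraph (Fin ℓ), (∀ n, 5 ≤ n → ¬ HasInducedCycleLen H n) →
      HoleFree H := fun H h c n hn hc => h n hn (hasInducedCycleLen_of_isInducedCycle hc)
  obtain ⟨n, hn, hcyc⟩ : ∃ n, 4 ≤ n ∧ HasInducedCycleLen G n := by
    simpa [Chordal] using hG'
  obtain ⟨c, hc⟩ := exists_isInducedCycle_of_hasInducedCycleLen (by omega) hcyc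
  have hle : pdLE (ModuleCat.of (Spoly ℓ) (logDer ℓ G)) 1 := by
    have := hasProjectiveDimensionLT_logVec (K := ℚ) (hholeFree G hG.1) (hholeFree Gᶜ hG.2)
    exact pdLE_one_of_hasProjectiveDimensionLE
      (hasProjectiveDimensionLT_of_iso (logDerEquiv ℓ G).symm.toModuleIso 2)
  have hnot : ¬ pdLE (ModuleCat.of (Spoly ℓ) (logDer ℓ G)) 0 := by
    intro h
    have : Module.Projective (Spoly ℓ) (logDer ℓ G) :=
      (IsProjective.iff_projective _).2 (projective_of_pdLE_zero h)
    exact not_projective_logVec hn hc (Module.Projective.of_equiv (logDerEquiv ℓ G))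
  refine le_antisymm (sInf_le ⟨1, rfl, hle⟩) (le_sInf ?_)
  rintro _ ⟨k, rfl, hk⟩
  rcases Nat.eq_zero_or_pos k with rfl | hk0
  · exact absurd hk hnot
  · exact_mod_cast hk0
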